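/- Let g : ℤ → ℤ be a grouping function, let S be a finite nonempty multiset of integers, let k ∈ {1,…,|S|}, and set q = select_{g(S)}(rank_{rank_{g⟦S⟧}(ℤ)}(k − 1)). Then select_S(k) = select_{S ∩ g⁻¹(q)}(k − select_{rank_{g⟦S⟧}(ℤ)}(rank_{g(S)}(q − 1) + 1)). -/

import Mathlib

/-- `mrank S j` is the rank of `j` in the multiset `S` of integers:
the number of elements of `S` (counted with multiplicity) that are at most `j`. -/
def mrank (S : Multiset ℤ) (j : ℤ) : ℕ := (S.filter (· ≤ j)).card

/-- `mselect S k` is the select operation: the least `j : ℤ` with `k ≤ mrank S j`. -/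
noncomputable def mselect (S : Multiset ℤ) (k : ℤ) : ℤ := sInf {j : ℤ | k ≤ (mrank S j : ℤ)}

/-- `srank A j` is the rank of `j` in the (simple) set `A` of integers. -/
noncomputable def srank (A : Set ℤ) (j : ℤ) : ℕ := {i ∈ A | i ≤ j}.ncard

/-- `sselect A k` is the select operation for a set of integers. -/
noncomputable def sselect (A : Set ℤ) (k : ℤ) : ℤ := sInf {j : ℤ | k ≤ (srank A j : ℤ)}

/-- The support `⟨S⟩` of a multiset of integers, as a set. -/
def msupp (S : Multiset ℤ) : Set ℤ := {x | x ∈ S}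

/-- `rank_S(ℤ)`: the image of the function `mrank S`, as a set of integers. -/
def rankImage (S : Multiset ℤ) : Set ℤ := Set.range fun j : ℤ => (mrank S j : ℤ)

/-- A grouping function: a nondecreasing `g : ℤ → ℤ` all of whose fibers are finite. -/
def GroupingFunction (g : ℤ → ℤ) : Prop := Monotone g ∧ ∀ q : ℤ, (g ⁻¹' {q}).Finite


theorem mrank_mono (S : Multiset ℤ) : Monotone (mrank S) := fun _ _ h =>
  Multiset.card_le_card (Multiset.monotone_filter_right S fun _ hx => le_trans hx h)

theorem mrank_le_card (S : Multiset ℤ) (t : ℤ) : mrank S t ≤ Multiset.card S :=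
  Multiset.card_le_card (Multiset.filter_le _ _)

theorem mrank_lt_mrank {S : Multiset ℤ} {a t : ℤ} (ha : a ∈ S) (h : t < a) :
    mrank S t < mrank S a := by
  refine Multiset.card_lt_card (lt_of_le_of_ne
    (Multiset.monotone_filter_right S fun _ hx => le_trans hx h.le) fun he => ?_)
  have h1 : a ∈ S.filter (· ≤ a) := Multiset.mem_filter.2 ⟨ha, le_rfl⟩
  rw [← he, Multiset.mem_filter] at h1
  exact absurd h1.2 (not_le.2 h)

theorem exists_forall_le_mem (S : Multiset ℤ) : ∃ b : ℤ, ∀ a ∈ S, b ≤ a := by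
  obtain ⟨b, hb⟩ := S.toFinset.bddBelow
  exact ⟨b, fun a ha => hb (by simpa using ha)⟩

theorem exists_mrank_eq_zero (S : Multiset ℤ) : ∃ b : ℤ, mrank S b = 0 := by
  obtain ⟨b, hb⟩ := exists_forall_le_mem S
  refine ⟨b - 1, ?_⟩
  rw [mrank, Multiset.card_eq_zero, Multiset.filter_eq_nil]
  intro a ha
  have := hb a ha
  omega

theorem exists_mrank_eq_card (S : Multiset ℤ) : ∃ b : ℤ, mrank S b = Multiset.card S := by
  obtain ⟨b, hb⟩ := S.toFinset.bddAbove
  refine ⟨b, ?_⟩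
  rw [mrank, Multiset.filter_eq_self.2]
  exact fun a ha => hb (by simpa using ha)

theorem mrank_eq_zero_or_exists_mem (S : Multiset ℤ) (s : ℤ) :
    mrank S s = 0 ∨ ∃ a ∈ S, a ≤ s ∧ mrank S a = mrank S s := by
  by_cases h : (S.filter (· ≤ s)).toFinset.Nonempty
  · right
    obtain ⟨a, ha, hmax⟩ := Finset.exists_max_image _ id h
    simp only [Multiset.mem_toFinset, Multiset.mem_filter, id] at ha hmax
    refine ⟨a, ha.1, ha.2, ?_⟩
    unfold mrank
    congr 1
    exact Multiset.filter_congr fun x hx => ⟨fun h => h.trans ha.2, fun h => hmax x ⟨hx, h⟩⟩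
  · left
    simpa [mrank, Multiset.toFinset_eq_empty, Finset.not_nonempty_iff_eq_empty] using h

theorem rankImage_finite (S : Multiset ℤ) : (rankImage S).Finite := by
  refine (Set.finite_Icc (0 : ℤ) (Multiset.card S)).subset ?_
  rintro _ ⟨t, rfl⟩
  have := mrank_le_card S t
  simp only [Set.mem_Icc]
  omega

theorem srank_mono {A : Set ℤ} (hA : A.Finite) : Monotone (srank A) := fun _ _ h =>
  Set.ncard_le_ncard (fun _ hx => ⟨hx.1, hx.2.trans h⟩) (hA.subset fun _ hx => hx.1)

theorem srank_lt_srank {A : Set ℤ} (hA : A.Finite) {a t : ℤ} (ha : a ∈ A) (h : t < a) :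
    srank A t < srank A a := by
  refine Set.ncard_lt_ncard ⟨fun _ hx => ⟨hx.1, hx.2.trans h.le⟩, fun hs => ?_⟩
    (hA.subset fun _ hx => hx.1)
  exact absurd (hs ⟨ha, le_rfl⟩ : a ∈ {i ∈ A | i ≤ t}).2 (not_le.2 h)

/-- The values of `mrank S` up to `mrank S t` are `0` and the ranks of the distinct elements of `S`
that are at most `t`. -/
theorem srank_rankImage_mrank (S : Multiset ℤ) (t : ℤ) :
    srank (rankImage S) (mrank S t) = srank (msupp S) t + 1 := by
  have hset : {x ∈ rankImage S | x ≤ (mrank S t : ℤ)} =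
      insert 0 ((fun a : ℤ => (mrank S a : ℤ)) '' {a ∈ msupp S | a ≤ t}) := by
    ext x
    constructor
    · rintro ⟨⟨s, rfl⟩, hs⟩
      obtain h0 | ⟨a, ha, has, he⟩ := mrank_eq_zero_or_exists_mem S s
      · left
        simp [h0]
      · refine Or.inr ⟨a, ⟨ha, ?_⟩, by simp [he]⟩
        by_contra! hlt
        have := mrank_lt_mrank ha hlt
        simp only at hs
        omega
    · rintro (rfl | ⟨a, ⟨-, hat⟩, rfl⟩)
      · obtain ⟨b, hb⟩ := exists_mrank_eq_zero S
        exact ⟨⟨b, by simp [hb]⟩, by positivity⟩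
      · exact ⟨⟨a, rfl⟩, Nat.cast_le.2 (mrank_mono S hat)⟩
  have hfin : {a ∈ msupp S | a ≤ t}.Finite :=
    S.toFinset.finite_toSet.subset fun a ha => by simpa [msupp] using ha.1
  have hinj : Set.InjOn (fun a : ℤ => (mrank S a : ℤ)) {a ∈ msupp S | a ≤ t} := by
    intro a ha b hb hab
    simp only [Nat.cast_inj] at hab
    rcases lt_trichotomy a b with h | h | h
    · exact absurd hab (mrank_lt_mrank hb.1 h).ne
    · exact h
    · exact absurd hab (mrank_lt_mrank ha.1 h).ne'
  have h0 : (0 : ℤ) ∉ (fun a : ℤ => (mrank S a : ℤ)) '' {a ∈ msupp S | a ≤ t} := by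
    rintro ⟨a, ha, h⟩
    have := mrank_lt_mrank ha.1 (sub_one_lt a)
    simp only at h
    omega
  rw [srank, hset, Set.ncard_insert_of_notMem h0 (hfin.image _), hinj.ncard_image,
    srank]

theorem sselect_srank_rankImage (S : Multiset ℤ) (k : ℤ) :
    sselect (msupp S) (srank (rankImage S) (k - 1)) = mselect S k := by
  unfold sselect mselect
  congr 1
  ext t
  have ht := srank_rankImage_mrank S t
  simp only [Set.mem_ofPred_eq, Nat.cast_le]
  constructor
  · intro h
    by_contra! hlt
    have := srank_mono (rankImage_finite S) (show (mrank S t : ℤ) ≤ k - 1 by omega)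
    omega
  · intro h
    have := srank_lt_srank (rankImage_finite S) (a := mrank S t) ⟨t, rfl⟩
      (show k - 1 < _ by omega)
    omega

theorem sselect_srank {A : Set ℤ} (hA : A.Finite) {a : ℤ} (ha : a ∈ A) :
    sselect A (srank A a) = a := by
  refine IsLeast.csInf_eq ⟨le_refl (srank A a : ℤ), fun j hj => ?_⟩
  by_contra! hlt
  have := srank_lt_srank hA ha hlt
  simp only [Set.mem_ofPred_eq] at hj
  omega

theorem isLeast_mselect (S : Multiset ℤ) {k : ℤ} (hk1 : 1 ≤ k)
    (hk2 : k ≤ (Multiset.card S : ℤ)) :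
    IsLeast {j : ℤ | k ≤ (mrank S j : ℤ)} (mselect S k) := by
  have hne : {j : ℤ | k ≤ (mrank S j : ℤ)}.Nonempty := by
    obtain ⟨b, hb⟩ := exists_mrank_eq_card S
    exact ⟨b, by simpa [hb] using hk2⟩
  have hbdd : BddBelow {j : ℤ | k ≤ (mrank S j : ℤ)} := by
    obtain ⟨b, hb⟩ := exists_mrank_eq_zero S
    refine ⟨b, fun j hj => ?_⟩
    by_contra! hlt
    have := mrank_mono S hlt.le
    simp only [Set.mem_ofPred_eq] at hj
    omega
  exact ⟨Int.csInf_mem hne hbdd, fun j hj => csInf_le hbdd hj⟩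

theorem mrank_map (S : Multiset ℤ) (g : ℤ → ℤ) (t : ℤ) :
    mrank (S.map g) t = (S.filter fun i => g i ≤ t).card := by
  rw [mrank, Multiset.filter_map, Multiset.card_map]
  rfl

theorem mrank_filter_add (S : Multiset ℤ) (g : ℤ → ℤ) (q j : ℤ) :
    mrank (S.filter fun i => g i = q) j + (S.filter fun i => g i ≤ q - 1 ∧ i ≤ j).card =
      (S.filter fun i => g i ≤ q ∧ i ≤ j).card := by
  rw [mrank, Multiset.filter_filter, ← Multiset.card_add, Multiset.filter_add_filter,
    Multiset.card_add]
  have h0 : (S.filter fun i => (i ≤ j ∧ g i = q) ∧ g i ≤ q - 1 ∧ i ≤ j) = 0 :=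
    Multiset.filter_eq_nil.2 fun i _ h => by omega
  rw [h0, Multiset.card_zero, add_zero]
  congr 1
  exact Multiset.filter_congr fun i _ => by omega

theorem le_mrank_iff_of_monotone {g : ℤ → ℤ} (hg : Monotone g) (S : Multiset ℤ) {k q : ℤ}
    (h1 : (mrank (S.map g) (q - 1) : ℤ) < k) (h2 : k ≤ mrank (S.map g) q) (j : ℤ) :
    k ≤ mrank S j ↔
      k - mrank (S.map g) (q - 1) ≤ mrank (S.filter fun i => g i = q) j := by
  have hadd := mrank_filter_add S g q j
  rw [mrank_map] at h1 h2 ⊢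
  rcases lt_trichotomy (g j) q with h | h | h
  · have ha : mrank S j ≤ (S.filter fun i => g i ≤ q - 1).card :=
      Multiset.card_le_card (Multiset.monotone_filter_right S fun i hi => by
        have := hg hi
        omega)
    have hb : mrank (S.filter fun i => g i = q) j = 0 := by
      rw [mrank, Multiset.card_eq_zero, Multiset.filter_filter, Multiset.filter_eq_nil]
      rintro i - ⟨hi, rfl⟩
      exact absurd (hg hi) (not_le.2 h)
    omega
  · have ha : (S.filter fun i => g i ≤ q - 1 ∧ i ≤ j) = S.filter fun i => g i ≤ q - 1 :=
      Multiset.filter_congr fun i _ => ⟨And.left, fun hi => ⟨hi, by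
        by_contra! hlt
        have := hg hlt.le
        omega⟩⟩
    have hb : (S.filter fun i => g i ≤ q ∧ i ≤ j) = S.filter (· ≤ j) :=
      Multiset.filter_congr fun i _ => ⟨And.right, fun hi => ⟨h ▸ hg hi, hi⟩⟩
    rw [ha, hb] at hadd
    change _ = mrank S j at hadd
    omega
  · have hlt : ∀ i, g i ≤ q → i ≤ j := fun i hi => by
      by_contra! hlt
      have := hg hlt.le
      omega
    have ha : (S.filter fun i => g i ≤ q - 1 ∧ i ≤ j) = S.filter fun i => g i ≤ q - 1 :=
      Multiset.filter_congr fun i _ => ⟨And.left, fun hi => ⟨hi, hlt i (by omega)⟩⟩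
    have hb : (S.filter fun i => g i ≤ q ∧ i ≤ j) = S.filter fun i => g i ≤ q :=
      Multiset.filter_congr fun i _ => ⟨And.left, fun hi => ⟨hi, hlt i hi⟩⟩
    have hc : (S.filter fun i => g i ≤ q).card ≤ mrank S j :=
      Multiset.card_le_card (Multiset.monotone_filter_right S fun i hi => hlt i hi)
    rw [ha, hb] at hadd
    omega

theorem stmt17 (g : ℤ → ℤ) (hg : GroupingFunction g) (S : Multiset ℤ) (hS : S ≠ 0)
    (k : ℤ) (hk1 : 1 ≤ k) (hk2 : k ≤ (Multiset.card S : ℤ))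
    (q : ℤ)
    (hq : q = sselect (g '' msupp S) ((srank (rankImage (S.map g)) (k - 1) : ℤ))) :
    mselect S k =
      mselect (S.filter fun i => g i = q)
        (k - sselect (rankImage (S.map g)) ((srank (g '' msupp S) (q - 1) : ℤ) + 1)) := by
  have hA : g '' msupp S = msupp (S.map g) := by
    ext x
    simp [msupp]
  rw [hA, sselect_srank_rankImage] at hq
  have hr : sselect (rankImage (S.map g)) ((srank (g '' msupp S) (q - 1) : ℤ) + 1) =
      mrank (S.map g) (q - 1) := by
    rw [hA, ← Nat.cast_add_one, ← srank_rankImage_mrank]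
    exact sselect_srank (rankImage_finite _) ⟨q - 1, rfl⟩
  have hl := isLeast_mselect (S.map g) hk1 (by simpa using hk2)
  rw [← hq] at hl
  have h1 : (mrank (S.map g) (q - 1) : ℤ) < k := by
    by_contra! h
    have := hl.2 h
    omega
  rw [hr, mselect, mselect]
  congr 1
  ext j
  exact le_mrank_iff_of_monotone hg.1 S h1 hl.1 j
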